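/- Let M*_lat be a base MDP over finite latent state space S and finite action space A with horizon H and reward distributions supported on a finite set R ⊆ [0,1], let ψ* be a decodable emission process with decoder φ*, and let M*_obs = ⟨M*_lat, ψ*⟩. Then for any T ∈ ℕ, any sequences of latent policies π^t_lat, base models M^t_lat over S, and maps φ^t = {φ^t_h : X → S} (t ∈ [T]), and any f : S × A → [0,1]: Σ_{t=1}^{T} Σ_{h=1}^{H} | E^{M^t_lat, π^t_lat}[f(s_h,a_h)] − E^{M*_obs, π^t_lat∘φ^t}[f(φ^t_h(x_h),a_h)] | ≤ H·√(T·H) · √( Σ_{t=1}^{T} Σ_{h=0}^{H} E^{M*_obs, π^t_lat∘φ^t}[Δ_h(M^t_lat, φ^t)(x_h,a_h)] ), where Δ_0(M^t_lat,φ^t) denotes the squared Hellinger distance between the initial distribution of M^t_lat and the pushforward under φ^t_1 of the initial distribution of M*_obs. -/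

import Mathlib

open Finset

attribute [local instance] Classical.propDecidable

/-- Occupancy measure of a finite-horizon MDP (layers 0-indexed). -/
noncomputable def docc {Z A : Type*} [Fintype Z] [Fintype A]
    (P0 : Z → ℝ) (P : ℕ → Z → A → Z → ℝ) (pol : ℕ → Z → A → ℝ) : ℕ → Z → ℝ
  | 0 => P0
  | h + 1 => fun z' => ∑ z, ∑ a, docc P0 P pol h z * pol h z a * P h z a z'

/-- Initial distribution of the latent-dynamics MDP `⟨M_lat, ψ⟩`; `ψ h s x = ψ_h(x|s)`. -/
noncomputable def obsInit {S X : Type*} (P0lat : S → ℝ) (ψ : ℕ → S → X → ℝ)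
    (φstar : ℕ → X → S) : X → ℝ :=
  fun x => P0lat (φstar 0 x) * ψ 0 (φstar 0 x) x

/-- Transition kernel of the latent-dynamics MDP `⟨M_lat, ψ⟩`. -/
noncomputable def obsTrans {S X A : Type*} (Plat : ℕ → S → A → S → ℝ)
    (ψ : ℕ → S → X → ℝ) (φstar : ℕ → X → S) : ℕ → X → A → X → ℝ :=
  fun h x a x' => Plat h (φstar h x) a (φstar (h + 1) x') * ψ (h + 1) (φstar (h + 1) x') x'

/-- Composition `π_lat ∘ φ`: `(π_lat∘φ)_h(a|x) = π_lat,h(a|φ_h(x))`. -/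
def compPol {S X A : Type*} (pol : ℕ → S → A → ℝ) (φ : ℕ → X → S) : ℕ → X → A → ℝ :=
  fun h x a => pol h (φ h x) a

/-- One-step joint model of the latent-dynamics MDP `M*_obs = ⟨M*_lat, ψ*⟩` over
(reward, next observation):  `M*_obs,h(r,x'|x,a) = R*_lat,h(r|φ*_h(x),a)·P*_obs,h(x'|x,a)`. -/
noncomputable def obsModel {S X A Rwd : Type*}
    (RlatStar : ℕ → S → A → Rwd → ℝ) (PlatStar : ℕ → S → A → S → ℝ)
    (ψ : ℕ → S → X → ℝ) (φstar : ℕ → X → S) : ℕ → X → A → Rwd → X → ℝ :=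
  fun h x a r x' => RlatStar h (φstar h x) a r * obsTrans PlatStar ψ φstar h x a x'

/-- Self-prediction error `Δ_h(M_lat, φ)(x,a)`: squared Hellinger distance between the
one-step joint model `M_lat,h(·,·|φ_h(x),a)` (given by reward distribution `R` and
kernel `P`) and the pushforward model `[φ_{h+1}♯M*_obs,h](·,·|x,a)`. -/
noncomputable def selfPredErr {S X A Rwd : Type*}
    [Fintype S] [Fintype X] [Fintype Rwd]
    (R : ℕ → S → A → Rwd → ℝ) (P : ℕ → S → A → S → ℝ)
    (RlatStar : ℕ → S → A → Rwd → ℝ) (PlatStar : ℕ → S → A → S → ℝ)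
    (ψ : ℕ → S → X → ℝ) (φstar : ℕ → X → S) (φ : ℕ → X → S)
    (h : ℕ) (x : X) (a : A) : ℝ :=
  ∑ r : Rwd, ∑ s' : S,
    (Real.sqrt (R h (φ h x) a r * P h (φ h x) a s')
      - Real.sqrt (∑ x' ∈ Finset.univ.filter (fun x' => φ (h + 1) x' = s'),
          obsModel RlatStar PlatStar ψ φstar h x a r x')) ^ 2

section Hellinger

/-- The `ℓ¹` distance of two probability mass functions is at most twice their Hellinger
distance. -/
lemma sum_abs_sub_le_hellinger {ι : Type*} [Fintype ι] (p q : ι → ℝ)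
    (hp : ∀ i, 0 ≤ p i) (hq : ∀ i, 0 ≤ q i) (hp1 : ∑ i, p i = 1) (hq1 : ∑ i, q i = 1) :
    ∑ i, |p i - q i| ≤ 2 * √(∑ i, (√(p i) - √(q i)) ^ 2) := by
  have hfac : ∀ i, |p i - q i| = |√(p i) - √(q i)| * (√(p i) + √(q i)) := fun i => by
    rw [← abs_of_nonneg (a := √(p i) + √(q i)) (by positivity), ← abs_mul]
    congr 1
    linear_combination -(Real.sq_sqrt (hp i)) + Real.sq_sqrt (hq i)
  have hsum : ∑ i, (√(p i) + √(q i)) ^ 2 ≤ 2 ^ 2 := by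
    calc ∑ i, (√(p i) + √(q i)) ^ 2 ≤ ∑ i, (2 * p i + 2 * q i) := by
          refine sum_le_sum fun i _ => ?_
          nlinarith [sq_nonneg (√(p i) - √(q i)), Real.sq_sqrt (hp i), Real.sq_sqrt (hq i)]
      _ = 2 ^ 2 := by rw [sum_add_distrib, ← mul_sum, ← mul_sum, hp1, hq1]; norm_num
  calc ∑ i, |p i - q i| = ∑ i, |√(p i) - √(q i)| * (√(p i) + √(q i)) :=
        sum_congr rfl fun i _ => hfac i
    _ ≤ √(∑ i, |√(p i) - √(q i)| ^ 2) * √(∑ i, (√(p i) + √(q i)) ^ 2) :=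
        Real.sum_mul_le_sqrt_mul_sqrt _ _ _
    _ ≤ √(∑ i, |√(p i) - √(q i)| ^ 2) * 2 := by
        gcongr
        exact Real.sqrt_le_left (by norm_num) |>.mpr hsum
    _ = 2 * √(∑ i, (√(p i) - √(q i)) ^ 2) := by simp only [sq_abs]; ring

/-- Jensen's inequality for the square root. -/
lemma sum_mul_sqrt_le_sqrt_sum_mul {ι : Type*} [Fintype ι] (w g : ι → ℝ)
    (hw : ∀ i, 0 ≤ w i) (hw1 : ∑ i, w i = 1) (hg : ∀ i, 0 ≤ g i) :
    ∑ i, w i * √(g i) ≤ √(∑ i, w i * g i) := by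
  calc ∑ i, w i * √(g i) = ∑ i, √(w i) * √(w i * g i) := by
        refine sum_congr rfl fun i _ => ?_
        rw [Real.sqrt_mul (hw i), ← mul_assoc, Real.mul_self_sqrt (hw i)]
    _ ≤ √(∑ i, w i) * √(∑ i, w i * g i) :=
        Real.sum_sqrt_mul_sqrt_le _ hw fun i => mul_nonneg (hw i) (hg i)
    _ = √(∑ i, w i * g i) := by rw [hw1, Real.sqrt_one, one_mul]

/-- Expectations of a `[0,1]`-valued function differ by at most half the `ℓ¹` distance. -/
lemma abs_sum_sub_mul_le {ι : Type*} [Fintype ι] (p q g : ι → ℝ)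
    (hpq : ∑ i, p i = ∑ i, q i) (hg : ∀ i, g i ∈ Set.Icc (0 : ℝ) 1) :
    |∑ i, (p i - q i) * g i| ≤ (∑ i, |p i - q i|) / 2 := by
  have hcenter : ∑ i, (p i - q i) * g i = ∑ i, (p i - q i) * (g i - 1 / 2) := by
    simp only [mul_sub, sum_sub_distrib, sub_mul, ← sum_mul, hpq]
    ring
  rw [hcenter, sum_div]
  refine (abs_sum_le_sum_abs _ _).trans (sum_le_sum fun i _ => ?_)
  rw [abs_mul, div_eq_mul_inv]
  refine mul_le_mul_of_nonneg_left ?_ (abs_nonneg _)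
  rw [abs_le]
  constructor <;> linarith [(hg i).1, (hg i).2]

end Hellinger

section Pushforward

lemma sum_pushforward_mul {X S : Type*} [Fintype X] [Fintype S] (φ : X → S) (g : X → ℝ)
    (F : S → ℝ) :
    ∑ s, (∑ x ∈ univ.filter (fun x => φ x = s), g x) * F s = ∑ x, g x * F (φ x) := by
  rw [← sum_fiberwise univ φ (fun x => g x * F (φ x))]
  refine sum_congr rfl fun s _ => ?_
  rw [sum_mul]
  refine sum_congr rfl fun x hx => ?_
  rw [(mem_filter.mp hx).2]

lemma sum_pushforward {X S : Type*} [Fintype X] [Fintype S] (φ : X → S) (g : X → ℝ) :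
    ∑ s, ∑ x ∈ univ.filter (fun x => φ x = s), g x = ∑ x, g x :=
  sum_fiberwise univ φ g

end Pushforward

section Occupancy

variable {Z A : Type*} [Fintype Z] [Fintype A]

lemma docc_nonneg {P0 : Z → ℝ} {P : ℕ → Z → A → Z → ℝ} {pol : ℕ → Z → A → ℝ} {H : ℕ}
    (hP0 : ∀ z, 0 ≤ P0 z) (hP : ∀ h, h + 1 < H → ∀ z a z', 0 ≤ P h z a z')
    (hpol : ∀ h, h < H → ∀ z a, 0 ≤ pol h z a) :
    ∀ h, h < H → ∀ z, 0 ≤ docc P0 P pol h z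
  | 0, _, z => hP0 z
  | h + 1, hh, z' => sum_nonneg fun z _ => sum_nonneg fun a _ =>
      mul_nonneg (mul_nonneg (docc_nonneg hP0 hP hpol h (by omega) z)
        (hpol h (by omega) z a)) (hP h hh z a z')

lemma sum_docc {P0 : Z → ℝ} {P : ℕ → Z → A → Z → ℝ} {pol : ℕ → Z → A → ℝ} {H : ℕ}
    (hP0 : ∑ z, P0 z = 1) (hP : ∀ h, h + 1 < H → ∀ z a, ∑ z', P h z a z' = 1)
    (hpol : ∀ h, h < H → ∀ z, ∑ a, pol h z a = 1) :
    ∀ h, h < H → ∑ z, docc P0 P pol h z = 1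
  | 0, _ => hP0
  | h + 1, hh => by
      calc ∑ z', docc P0 P pol (h + 1) z'
          = ∑ z, ∑ a, ∑ z', docc P0 P pol h z * pol h z a * P h z a z' := by
            simp only [docc]
            rw [sum_comm]
            exact sum_congr rfl fun z _ => sum_comm
        _ = 1 := by
            simp only [← mul_sum, hP h hh, hpol h (by omega), mul_one]
            exact sum_docc hP0 hP hpol h (by omega)

end Occupancy

section Observation

variable {S X : Type*} [Fintype S] [Fintype X]

lemma sum_emission {ψ : S → X → ℝ} {φstar : X → S} (hψsum : ∀ s, ∑ x, ψ s x = 1)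
    (hφstar : ∀ s x, ψ s x ≠ 0 → φstar x = s) (p : S → ℝ) :
    ∑ x, p (φstar x) * ψ (φstar x) x = ∑ s, p s := by
  rw [← sum_fiberwise univ φstar]
  refine sum_congr rfl fun s _ => ?_
  calc ∑ x ∈ univ.filter (fun x => φstar x = s), p (φstar x) * ψ (φstar x) x
      = ∑ x ∈ univ.filter (fun x => φstar x = s), p s * ψ s x :=
        sum_congr rfl fun x hx => by rw [(mem_filter.mp hx).2]
    _ = ∑ x, p s * ψ s x := by
        refine sum_filter_of_ne fun x _ hx => hφstar s x fun h0 => hx ?_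
        rw [h0, mul_zero]
    _ = p s := by rw [← mul_sum, hψsum, mul_one]

end Observation

section Simulation

variable {S X A : Type*} [Fintype S] [Fintype X] [Fintype A]

/-- The `ℓ¹` distance between the latent occupancy and the pushed-forward occupancy of the
observation MDP is bounded by accumulated one-step `ℓ¹` errors. -/
lemma sum_abs_docc_sub_pushforward_le {P0 : S → ℝ} {P : ℕ → S → A → S → ℝ}
    {pol : ℕ → S → A → ℝ} {Q0 : X → ℝ} {Q : ℕ → X → A → X → ℝ} (φ : ℕ → X → S) {H : ℕ}
    (hP : ∀ h, h + 1 < H → ∀ s a s', 0 ≤ P h s a s')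
    (hPsum : ∀ h, h + 1 < H → ∀ s a, ∑ s', P h s a s' = 1)
    (hpol : ∀ h, h < H → ∀ s a, 0 ≤ pol h s a)
    (hpolsum : ∀ h, h < H → ∀ s, ∑ a, pol h s a = 1)
    (hQ0 : ∀ x, 0 ≤ Q0 x) (hQ : ∀ h, h + 1 < H → ∀ x a x', 0 ≤ Q h x a x')
    (h : ℕ) (hh : h < H) :
    ∑ s, |docc P0 P pol h s
        - ∑ x ∈ univ.filter (fun x => φ h x = s), docc Q0 Q (compPol pol φ) h x|
      ≤ (∑ s, |P0 s - ∑ x ∈ univ.filter (fun x => φ 0 x = s), Q0 x|)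
        + ∑ k ∈ range h, ∑ x, ∑ a,
          docc Q0 Q (compPol pol φ) k x * compPol pol φ k x a
            * ∑ s', |P k (φ k x) a s'
                - ∑ x' ∈ univ.filter (fun x' => φ (k + 1) x' = s'), Q k x a x'| := by
  induction h with
  | zero => simp [docc]
  | succ h ih =>
    rw [sum_range_succ, ← add_assoc]
    refine le_trans ?_ (add_le_add_left (ih (by omega)) _)
    set d := docc Q0 Q (compPol pol φ) h
    have hd0 : ∀ x, 0 ≤ d x :=
      docc_nonneg hQ0 hQ (fun k hk x a => hpol k hk (φ k x) a) h (by omega)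
    have hsplit : ∀ s', docc P0 P pol (h + 1) s'
          - ∑ x ∈ univ.filter (fun x => φ (h + 1) x = s'), docc Q0 Q (compPol pol φ) (h + 1) x
        = (∑ s, ∑ a, (docc P0 P pol h s - ∑ x ∈ univ.filter (fun x => φ h x = s), d x)
            * (pol h s a * P h s a s'))
          + ∑ x, ∑ a, d x * compPol pol φ h x a * (P h (φ h x) a s'
            - ∑ x' ∈ univ.filter (fun x' => φ (h + 1) x' = s'), Q h x a x') := by
      intro s'
      have hmid : ∑ s, (∑ x ∈ univ.filter (fun x => φ h x = s), d x)
            * (∑ a, pol h s a * P h s a s')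
          = ∑ x, d x * ∑ a, pol h (φ h x) a * P h (φ h x) a s' :=
        sum_pushforward_mul (φ h) d fun s => ∑ a, pol h s a * P h s a s'
      have hpush : ∑ x ∈ univ.filter (fun x => φ (h + 1) x = s'),
            docc Q0 Q (compPol pol φ) (h + 1) x
          = ∑ x, ∑ a, d x * compPol pol φ h x a
            * ∑ x' ∈ univ.filter (fun x' => φ (h + 1) x' = s'), Q h x a x' := by
        simp only [docc, mul_sum]
        rw [sum_comm]
        exact sum_congr rfl fun x _ => sum_comm
      rw [hpush]
      simp only [← mul_sum, sub_mul, sum_sub_distrib, mul_sub, hmid]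
      simp only [docc, compPol, mul_sum, mul_assoc]
      ring
    calc ∑ s', |docc P0 P pol (h + 1) s'
          - ∑ x ∈ univ.filter (fun x => φ (h + 1) x = s'), docc Q0 Q (compPol pol φ) (h + 1) x|
        ≤ ∑ s', ((∑ s, ∑ a,
            |docc P0 P pol h s - ∑ x ∈ univ.filter (fun x => φ h x = s), d x|
              * (pol h s a * P h s a s'))
          + ∑ x, ∑ a, d x * compPol pol φ h x a * |P h (φ h x) a s'
            - ∑ x' ∈ univ.filter (fun x' => φ (h + 1) x' = s'), Q h x a x'|) := by
          refine sum_le_sum fun s' _ => ?_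
          rw [hsplit]
          refine (abs_add_le _ _).trans (add_le_add ?_ ?_)
          · refine (abs_sum_le_sum_abs _ _).trans (sum_le_sum fun s _ => ?_)
            refine (abs_sum_le_sum_abs _ _).trans (sum_le_sum fun a _ => ?_)
            rw [abs_mul, abs_of_nonneg (mul_nonneg (hpol h (by omega) s a) (hP h hh s a s'))]
          · refine (abs_sum_le_sum_abs _ _).trans (sum_le_sum fun x _ => ?_)
            refine (abs_sum_le_sum_abs _ _).trans (sum_le_sum fun a _ => ?_)
            have hw : 0 ≤ d x * compPol pol φ h x a :=
              mul_nonneg (hd0 x) (hpol h (by omega) (φ h x) a)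
            rw [abs_mul, abs_of_nonneg hw]
      _ = _ := by
          rw [sum_add_distrib]
          congr 1
          · rw [sum_comm]
            refine sum_congr rfl fun s _ => ?_
            rw [sum_comm]
            simp only [← mul_sum, hPsum h hh, hpolsum h (by omega), mul_one]
          · rw [sum_comm]
            refine sum_congr rfl fun x _ => ?_
            rw [sum_comm]
            simp only [mul_sum]

end Simulation

/-- One-step `ℓ¹` transition error is controlled by the self-prediction error. -/
lemma sum_abs_trans_sub_pushforward_le_selfPredErr {S X A Rwd : Type*}
    [Fintype S] [Fintype X] [Fintype Rwd]
    {R : ℕ → S → A → Rwd → ℝ} {P : ℕ → S → A → S → ℝ}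
    {RlatStar : ℕ → S → A → Rwd → ℝ} {PlatStar : ℕ → S → A → S → ℝ}
    {ψ : ℕ → S → X → ℝ} {φstar : ℕ → X → S} (φ : ℕ → X → S) (h : ℕ) (x : X) (a : A)
    (hR : ∀ s r, 0 ≤ R h s a r) (hRsum : ∀ s, ∑ r, R h s a r = 1)
    (hP : ∀ s s', 0 ≤ P h s a s') (hPsum : ∀ s, ∑ s', P h s a s' = 1)
    (hRStar : ∀ s r, 0 ≤ RlatStar h s a r) (hRStarsum : ∀ s, ∑ r, RlatStar h s a r = 1)
    (hQ : ∀ x', 0 ≤ obsTrans PlatStar ψ φstar h x a x')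
    (hQsum : ∑ x', obsTrans PlatStar ψ φstar h x a x' = 1) :
    ∑ s', |P h (φ h x) a s' - ∑ x' ∈ univ.filter (fun x' => φ (h + 1) x' = s'),
        obsTrans PlatStar ψ φstar h x a x'|
      ≤ 2 * √(selfPredErr R P RlatStar PlatStar ψ φstar φ h x a) := by
  set p : Rwd × S → ℝ := fun i => R h (φ h x) a i.1 * P h (φ h x) a i.2 with hp
  set q : Rwd × S → ℝ := fun i => ∑ x' ∈ univ.filter (fun x' => φ (h + 1) x' = i.2),
    obsModel RlatStar PlatStar ψ φstar h x a i.1 x' with hq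
  have hqmul : ∀ i, q i = RlatStar h (φstar h x) a i.1
      * ∑ x' ∈ univ.filter (fun x' => φ (h + 1) x' = i.2),
          obsTrans PlatStar ψ φstar h x a x' := fun i => by
    simp only [hq, obsModel, mul_sum]
  have hhell : ∑ i, |p i - q i| ≤ 2 * √(∑ i, (√(p i) - √(q i)) ^ 2) := by
    refine sum_abs_sub_le_hellinger p q (fun i => mul_nonneg (hR _ _) (hP _ _))
      (fun i => ?_) ?_ ?_
    · rw [hqmul]
      exact mul_nonneg (hRStar _ _) (sum_nonneg fun x' _ => hQ x')
    · simp only [hp, Fintype.sum_prod_type, ← mul_sum, hPsum, mul_one, hRsum]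
    · simp only [hqmul, Fintype.sum_prod_type, ← mul_sum, sum_pushforward, hQsum, mul_one,
        hRStarsum]
  have herr : ∑ i, (√(p i) - √(q i)) ^ 2
      = selfPredErr R P RlatStar PlatStar ψ φstar φ h x a := by
    rw [Fintype.sum_prod_type, selfPredErr]
  rw [herr] at hhell
  refine le_trans ?_ hhell
  rw [Fintype.sum_prod_type_right]
  refine sum_le_sum fun s' _ => ?_
  refine le_trans (le_of_eq ?_) (abs_sum_le_sum_abs _ _)
  rw [sum_sub_distrib]
  simp only [hqmul, hp, ← sum_mul, hRsum, hRStarsum, one_mul]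

lemma sum_sqrt_le_sqrt_card_mul {ι : Type*} (s : Finset ι) (g : ι → ℝ)
    (hg : ∀ i ∈ s, 0 ≤ g i) :
    ∑ i ∈ s, √(g i) ≤ √(s.card) * √(∑ i ∈ s, g i) := by
  calc ∑ i ∈ s, √(g i) = ∑ i ∈ s, 1 * √(g i) := by simp only [one_mul]
    _ ≤ √(∑ _i ∈ s, 1 ^ 2) * √(∑ i ∈ s, √(g i) ^ 2) := Real.sum_mul_le_sqrt_mul_sqrt _ _ _
    _ = √(s.card) * √(∑ i ∈ s, g i) := by
        rw [sum_congr rfl fun i hi => Real.sq_sqrt (hg i hi)]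
        simp

/-- Aggregated simulation lemma: for sequences of latent policies
`π^t`, base models `M^t_lat` and maps `φ^t` (`t < T`), and any `f : S×A → [0,1]`,
`Σ_{t<T} Σ_{h<H} |E^{M^t,π^t}[f(s_h,a_h)] − E^{M*_obs,π^t∘φ^t}[f(φ^t_h(x_h),a_h)]|
  ≤ H·√(T·H)·√(Σ_{t<T} (Δ₀(t) + Σ_{h<H-1} E^{M*_obs,π^t∘φ^t}[Δ_h(M^t_lat,φ^t)(x_h,a_h)]))`,
where `Δ₀(t)` is the squared Hellinger distance between the initial distribution of
`M^t_lat` and the `φ^t_1`-pushforward of the initial distribution of `M*_obs`. -/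
theorem statement14 (S X A Rwd : Type*)
    [Fintype S] [Fintype X] [Fintype A] [Fintype Rwd]
    [Nonempty S] [Nonempty X] [Nonempty A]
    (H : ℕ) (hH : 0 < H)
    (Rval : Rwd → ℝ) (hRval : ∀ r, Rval r ∈ Set.Icc (0:ℝ) 1)
    -- the true latent model M*_lat (initial dist, transitions, reward dists) and emission
    (P0latStar : S → ℝ) (h00 : ∀ s, 0 ≤ P0latStar s) (h01 : ∑ s, P0latStar s = 1)
    (PlatStar : ℕ → S → A → S → ℝ)
    (hPnnStar : ∀ h, h + 1 < H → ∀ s a s', 0 ≤ PlatStar h s a s')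
    (hPsumStar : ∀ h, h + 1 < H → ∀ s a, ∑ s', PlatStar h s a s' = 1)
    (RlatStar : ℕ → S → A → Rwd → ℝ)
    (hRnnStar : ∀ h, h < H → ∀ s a r, 0 ≤ RlatStar h s a r)
    (hRsumStar : ∀ h, h < H → ∀ s a, ∑ r, RlatStar h s a r = 1)
    (ψ : ℕ → S → X → ℝ)
    (hψnn : ∀ h, h < H → ∀ s x, 0 ≤ ψ h s x)
    (hψsum : ∀ h, h < H → ∀ s, ∑ x, ψ h s x = 1)
    (hdec : ∀ h, h < H → ∀ s s' x, s ≠ s' → ψ h s x ≠ 0 → ψ h s' x = 0)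
    (φstar : ℕ → X → S)
    (hφstar : ∀ h, h < H → ∀ s x, ψ h s x ≠ 0 → φstar h x = s)
    -- horizon of interaction and the sequences
    (T : ℕ)
    (P0t : ℕ → S → ℝ)
    (hP0t : ∀ t, t < T → (∀ s, 0 ≤ P0t t s) ∧ ∑ s, P0t t s = 1)
    (Pt : ℕ → ℕ → S → A → S → ℝ)
    (hPt : ∀ t, t < T → ∀ h, h + 1 < H → ∀ s a,
        (∀ s', 0 ≤ Pt t h s a s') ∧ ∑ s', Pt t h s a s' = 1)
    (Rt : ℕ → ℕ → S → A → Rwd → ℝ)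
    (hRt : ∀ t, t < T → ∀ h, h < H → ∀ s a,
        (∀ r, 0 ≤ Rt t h s a r) ∧ ∑ r, Rt t h s a r = 1)
    (πt : ℕ → ℕ → S → A → ℝ)
    (hπt : ∀ t, t < T → ∀ h, h < H → ∀ s, (∀ a, 0 ≤ πt t h s a) ∧ ∑ a, πt t h s a = 1)
    (φt : ℕ → ℕ → X → S)
    (f : S → A → ℝ) (hf : ∀ s a, f s a ∈ Set.Icc (0:ℝ) 1) :
    ∑ t ∈ Finset.range T, ∑ h ∈ Finset.range H,
        |(∑ s, ∑ a, docc (P0t t) (Pt t) (πt t) h s * πt t h s a * f s a)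
          - ∑ x, ∑ a,
              docc (obsInit P0latStar ψ φstar) (obsTrans PlatStar ψ φstar)
                  (compPol (πt t) (φt t)) h x
                * compPol (πt t) (φt t) h x a * f (φt t h x) a|
      ≤ (H : ℝ) * Real.sqrt ((T : ℝ) * H) *
          Real.sqrt (∑ t ∈ Finset.range T,
            ((∑ s, (Real.sqrt (P0t t s)
                - Real.sqrt (∑ x ∈ Finset.univ.filter (fun x => φt t 0 x = s),
                    obsInit P0latStar ψ φstar x)) ^ 2)
            + ∑ h ∈ Finset.range (H - 1), ∑ x, ∑ a,
                docc (obsInit P0latStar ψ φstar) (obsTrans PlatStar ψ φstar)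
                    (compPol (πt t) (φt t)) h x
                  * compPol (πt t) (φt t) h x a
                  * selfPredErr (Rt t) (Pt t) RlatStar PlatStar ψ φstar (φt t) h x a)) := by
  have hQ0 : ∀ x, 0 ≤ obsInit P0latStar ψ φstar x := fun x =>
    mul_nonneg (h00 _) (hψnn 0 hH _ _)
  have hQ0sum : ∑ x, obsInit P0latStar ψ φstar x = 1 :=
    (sum_emission (hψsum 0 hH) (hφstar 0 hH) P0latStar).trans h01
  have hQ : ∀ h, h + 1 < H → ∀ x (a : A) x', 0 ≤ obsTrans PlatStar ψ φstar h x a x' :=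
    fun h hh x a x' => mul_nonneg (hPnnStar h hh _ _ _) (hψnn (h + 1) hh _ _)
  have hQsum : ∀ h, h + 1 < H → ∀ x (a : A), ∑ x', obsTrans PlatStar ψ φstar h x a x' = 1 :=
    fun h hh x a => (sum_emission (hψsum (h + 1) hh) (hφstar (h + 1) hh)
      (PlatStar h (φstar h x) a)).trans (hPsumStar h hh _ a)
  set Q0 := obsInit P0latStar ψ φstar
  set Q : ℕ → X → A → X → ℝ := obsTrans PlatStar ψ φstar
  set w : ℕ → ℕ → X → A → ℝ := fun t h x a =>
    docc Q0 Q (compPol (πt t) (φt t)) h x * compPol (πt t) (φt t) h x a with hw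
  set Δ : ℕ → ℕ → X → A → ℝ := fun t =>
    selfPredErr (Rt t) (Pt t) RlatStar PlatStar ψ φstar (φt t) with hΔ
  set e : ℕ → ℕ → ℝ := fun t k => Nat.casesOn k
    (∑ s, (√(P0t t s) - √(∑ x ∈ univ.filter (fun x => φt t 0 x = s), Q0 x)) ^ 2)
    (fun k => ∑ x, ∑ a, w t k x a * Δ t k x a)
  have hΔnn : ∀ t k x a, 0 ≤ Δ t k x a := fun t k x a =>
    sum_nonneg fun _ _ => sum_nonneg fun _ _ => sq_nonneg _
  have hdnn : ∀ t, t < T → ∀ h, h < H → ∀ x,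
      0 ≤ docc Q0 Q (compPol (πt t) (φt t)) h x := fun t ht =>
    docc_nonneg hQ0 hQ fun k hk x a => (hπt t ht k hk (φt t k x)).1 a
  have hdsum : ∀ t, t < T → ∀ h, h < H →
      ∑ x, docc Q0 Q (compPol (πt t) (φt t)) h x = 1 := fun t ht =>
    sum_docc hQ0sum hQsum fun k hk x => (hπt t ht k hk (φt t k x)).2
  have hwnn : ∀ t, t < T → ∀ h, h < H → ∀ x a, 0 ≤ w t h x a := fun t ht h hh x a =>
    mul_nonneg (hdnn t ht h hh x) ((hπt t ht h hh (φt t h x)).1 a)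
  have hwsum : ∀ t, t < T → ∀ h, h < H → ∑ x, ∑ a, w t h x a = 1 := fun t ht h hh => by
    simp only [hw, compPol, ← mul_sum, (hπt t ht h hh _).2, mul_one]
    exact hdsum t ht h hh
  have henn : ∀ t, t < T → ∀ k, k < H → 0 ≤ e t k := by
    rintro t ht (_ | k) hk
    · exact sum_nonneg fun _ _ => sq_nonneg _
    · exact sum_nonneg fun x _ => sum_nonneg fun a _ =>
        mul_nonneg (hwnn t ht k (by omega) x a) (hΔnn t k x a)
  have hstep : ∀ t, t < T → ∀ k, k + 1 < H →
      ∑ x, ∑ a, w t k x a * ∑ s', |Pt t k (φt t k x) a s'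
        - ∑ x' ∈ univ.filter (fun x' => φt t (k + 1) x' = s'), Q k x a x'|
      ≤ 2 * √(e t (k + 1)) := by
    intro t ht k hk
    have hk' : k < H := by omega
    calc _ ≤ ∑ x, ∑ a, w t k x a * (2 * √(Δ t k x a)) := by
          refine sum_le_sum fun x _ => sum_le_sum fun a _ =>
            mul_le_mul_of_nonneg_left ?_ (hwnn t ht k hk' x a)
          exact sum_abs_trans_sub_pushforward_le_selfPredErr (φt t) k x a
            (fun s => (hRt t ht k hk' s a).1) (fun s => (hRt t ht k hk' s a).2)
            (fun s => (hPt t ht k hk s a).1) (fun s => (hPt t ht k hk s a).2)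
            (fun s => hRnnStar k hk' s a) (fun s => hRsumStar k hk' s a)
            (hQ k hk x a) (hQsum k hk x a)
      _ = 2 * ∑ i : X × A, w t k i.1 i.2 * √(Δ t k i.1 i.2) := by
          rw [Fintype.sum_prod_type, mul_sum]
          refine sum_congr rfl fun x _ => ?_
          rw [mul_sum]
          exact sum_congr rfl fun a _ => by ring
      _ ≤ 2 * √(∑ i : X × A, w t k i.1 i.2 * Δ t k i.1 i.2) := by
          refine mul_le_mul_of_nonneg_left (sum_mul_sqrt_le_sqrt_sum_mul
            (fun i : X × A => w t k i.1 i.2) (fun i : X × A => Δ t k i.1 i.2)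
            (fun i => hwnn t ht k hk' _ _) ?_ fun i => hΔnn t k _ _) zero_le_two
          rw [Fintype.sum_prod_type]
          exact hwsum t ht k hk'
      _ = 2 * √(e t (k + 1)) := by rw [Fintype.sum_prod_type]
  have hinit : ∀ t, t < T →
      ∑ s, |P0t t s - ∑ x ∈ univ.filter (fun x => φt t 0 x = s), Q0 x| ≤ 2 * √(e t 0) :=
    fun t ht => sum_abs_sub_le_hellinger (P0t t) _ (hP0t t ht).1
      (fun s => sum_nonneg fun x _ => hQ0 x) (hP0t t ht).2
      ((sum_pushforward _ _).trans hQ0sum)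
  have hterm : ∀ t, t < T → ∀ h, h < H →
      |(∑ s, ∑ a, docc (P0t t) (Pt t) (πt t) h s * πt t h s a * f s a)
        - ∑ x, ∑ a, w t h x a * f (φt t h x) a| ≤ ∑ k ∈ range H, √(e t k) := by
    intro t ht h hh
    set p : S → ℝ := docc (P0t t) (Pt t) (πt t) h
    set q : S → ℝ := fun s => ∑ x ∈ univ.filter (fun x => φt t h x = s),
      docc Q0 Q (compPol (πt t) (φt t)) h x
    set g : S → ℝ := fun s => ∑ a, πt t h s a * f s a with hg
    have hdiff : (∑ s, ∑ a, p s * πt t h s a * f s a) - ∑ x, ∑ a, w t h x a * f (φt t h x) a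
        = ∑ s, (p s - q s) * g s := by
      have hpush : ∑ s, q s * g s = ∑ x, docc Q0 Q (compPol (πt t) (φt t)) h x * g (φt t h x) :=
        sum_pushforward_mul (φt t h) _ g
      simp only [sub_mul, sum_sub_distrib, hpush]
      simp only [hw, hg, compPol, mul_sum, mul_assoc]
    have hgmem : ∀ s, g s ∈ Set.Icc (0 : ℝ) 1 := fun s => by
      refine ⟨sum_nonneg fun a _ => mul_nonneg ((hπt t ht h hh s).1 a) (hf s a).1, ?_⟩
      rw [← (hπt t ht h hh s).2]
      exact sum_le_sum fun a _ => mul_le_of_le_one_right ((hπt t ht h hh s).1 a) (hf s a).2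
    have hmass : ∑ s, p s = ∑ s, q s := by
      rw [sum_pushforward, hdsum t ht h hh]
      exact sum_docc (hP0t t ht).2 (fun k hk s a => (hPt t ht k hk s a).2)
        (fun k hk s => (hπt t ht k hk s).2) h hh
    have hl1 : ∑ s, |p s - q s| ≤ 2 * ∑ k ∈ range H, √(e t k) := by
      calc ∑ s, |p s - q s| ≤ _ :=
            sum_abs_docc_sub_pushforward_le (φt t) (fun k hk s a => (hPt t ht k hk s a).1)
              (fun k hk s a => (hPt t ht k hk s a).2) (fun k hk s => (hπt t ht k hk s).1)
              (fun k hk s => (hπt t ht k hk s).2) hQ0 hQ h hh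
        _ ≤ 2 * √(e t 0) + ∑ k ∈ range h, 2 * √(e t (k + 1)) :=
            add_le_add (hinit t ht) (sum_le_sum fun k hk =>
              hstep t ht k (by have := mem_range.mp hk; omega))
        _ = 2 * ∑ k ∈ range (h + 1), √(e t k) := by
            rw [sum_range_succ', ← mul_sum]; ring
        _ ≤ 2 * ∑ k ∈ range H, √(e t k) := by
            refine mul_le_mul_of_nonneg_left (sum_le_sum_of_subset_of_nonneg
              (range_subset_range.mpr hh) fun _ _ _ => Real.sqrt_nonneg _) zero_le_two
    rw [hdiff]
    linarith [abs_sum_sub_mul_le p q g hmass hgmem]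
  have hrhs : ∀ t, (∑ s, (√(P0t t s)
        - √(∑ x ∈ univ.filter (fun x => φt t 0 x = s), Q0 x)) ^ 2)
      + ∑ h ∈ range (H - 1), ∑ x, ∑ a, w t h x a * Δ t h x a = ∑ k ∈ range H, e t k := by
    intro t
    obtain ⟨n, rfl⟩ : ∃ n, H = n + 1 := ⟨H - 1, by omega⟩
    rw [sum_range_succ', add_comm, Nat.add_sub_cancel]
    rfl
  calc _ ≤ ∑ t ∈ range T, ∑ h ∈ range H, ∑ k ∈ range H, √(e t k) :=
        sum_le_sum fun t ht => sum_le_sum fun h hh =>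
          hterm t (mem_range.mp ht) h (mem_range.mp hh)
    _ = H * ∑ i ∈ range T ×ˢ range H, √(e i.1 i.2) := by
        rw [sum_product, mul_sum]
        simp
    _ ≤ H * (√(T * H) * √(∑ i ∈ range T ×ˢ range H, e i.1 i.2)) := by
        refine mul_le_mul_of_nonneg_left ?_ (Nat.cast_nonneg H)
        simpa using sum_sqrt_le_sqrt_card_mul (range T ×ˢ range H) (fun i => e i.1 i.2)
          fun i hi => henn _ (mem_range.mp (mem_product.mp hi).1) _
            (mem_range.mp (mem_product.mp hi).2)
    _ = _ := by
        rw [sum_product, ← mul_assoc]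
        simp only [← hrhs, hw, hΔ]
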